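/- In the isthmus setting with generic parameters, if (x,λ₀) ∈ (ℂ∖{0})^d × ℂ is a critical point of D and x_j² ≠ 1 for some index j, then both P_{f(j)}(x,λ₀) = 0 and Q_{f(j)}(x,λ₀) = 0. -/

import Mathlib

/-- The principal minor: determinant of the submatrix of `N` on rows and columns of index
`< s` (equal to `1` when `s = 0`). -/
noncomputable def Pminor {n : ℕ} (N : Matrix (Fin n) (Fin n) ℂ) (s : ℕ) : ℂ :=
  (N.submatrix (fun i : Fin (min s n) => Fin.castLE (min_le_right s n) i)
    (fun i : Fin (min s n) => Fin.castLE (min_le_right s n) i)).det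

/-- The co-principal minor: determinant of the submatrix of `N` on rows and columns of index
`> s` (equal to `1` when `s = n − 1`). -/
noncomputable def Qminor {n : ℕ} (N : Matrix (Fin n) (Fin n) ℂ) (s : ℕ) : ℂ :=
  (N.submatrix (fun i : Fin (n - 1 - s) => (⟨s + 1 + i.1, by have := i.2; omega⟩ : Fin n))
    (fun i : Fin (n - 1 - s) => (⟨s + 1 + i.1, by have := i.2; omega⟩ : Fin n))).det

/-- The Floquet matrix of a periodic isthmus-connected graph: the matrix `M` with
`E_j·(z_j + z_j⁻¹)` added to the diagonal entry `(f j, f j)` for each `j`. -/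
noncomputable def isthH (a m b d : ℕ) (M : Matrix (Fin (a + m + b)) (Fin (a + m + b)) ℝ)
    (f : Fin d → Fin (a + m + b)) (E : Fin d → ℝ) (z : Fin d → ℂ) :
    Matrix (Fin (a + m + b)) (Fin (a + m + b)) ℂ :=
  Matrix.of fun i i' => (M i i' : ℂ) +
    if i = i' then ∑ j, (if f j = i then (E j : ℂ) * (z j + (z j)⁻¹) else 0) else 0

/-- The dispersion polynomial `D(z,λ) = det(H(z) − λ·I)`. -/
noncomputable def isthD (a m b d : ℕ) (M : Matrix (Fin (a + m + b)) (Fin (a + m + b)) ℝ)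
    (f : Fin d → Fin (a + m + b)) (E : Fin d → ℝ) (z : Fin d → ℂ) (lam : ℂ) : ℂ :=
  (isthH a m b d M f E z - lam • 1).det

/-- `P_s(z,λ)`: the principal minor of `H(z) − λ·I` on indices `< s`. -/
noncomputable def isthP (a m b d : ℕ) (M : Matrix (Fin (a + m + b)) (Fin (a + m + b)) ℝ)
    (f : Fin d → Fin (a + m + b)) (E : Fin d → ℝ) (s : ℕ) (z : Fin d → ℂ) (lam : ℂ) : ℂ :=
  Pminor (isthH a m b d M f E z - lam • 1) s

/-- `Q_s(z,λ)`: the co-principal minor of `H(z) − λ·I` on indices `> s`. -/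
noncomputable def isthQ (a m b d : ℕ) (M : Matrix (Fin (a + m + b)) (Fin (a + m + b)) ℝ)
    (f : Fin d → Fin (a + m + b)) (E : Fin d → ℝ) (s : ℕ) (z : Fin d → ℂ) (lam : ℂ) : ℂ :=
  Qminor (isthH a m b d M f E z - lam • 1) s

/-- The partial derivative `∂D/∂z_j`. -/
noncomputable def isthPD (a m b d : ℕ) (M : Matrix (Fin (a + m + b)) (Fin (a + m + b)) ℝ)
    (f : Fin d → Fin (a + m + b)) (E : Fin d → ℝ) (j : Fin d) (z : Fin d → ℂ) (lam : ℂ) : ℂ :=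
  deriv (fun t => isthD a m b d M f E (Function.update z j t) lam) (z j)

/-- The second partial derivative `∂²D/∂z_j∂z_i`. -/
noncomputable def isthPD2 (a m b d : ℕ) (M : Matrix (Fin (a + m + b)) (Fin (a + m + b)) ℝ)
    (f : Fin d → Fin (a + m + b)) (E : Fin d → ℝ) (i j : Fin d) (z : Fin d → ℂ) (lam : ℂ) : ℂ :=
  deriv (fun s => isthPD a m b d M f E i (Function.update z j s) lam) (z j)

open Matrix in
/-- A nonzero vector supported on `p` is annihilated by the compression of `N` to `p`. -/
def HasKernelOn {ι K : Type*} [Fintype ι] [Field K] (N : Matrix ι ι K) (p : ι → Prop) : Prop :=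
  ∃ v : ι → K, v ≠ 0 ∧ (∀ i, ¬ p i → v i = 0) ∧ ∀ i, p i → (N *ᵥ v) i = 0

section HasKernelOn

open Matrix

variable {ι κ K : Type*} [Fintype ι] [Fintype κ] [DecidableEq κ] [Field K]

theorem HasKernelOn.congr {N : Matrix ι ι K} {p q : ι → Prop} (h : HasKernelOn N p)
    (hpq : ∀ i, p i ↔ q i) : HasKernelOn N q := by
  obtain rfl : p = q := funext fun i => propext (hpq i)
  exact h

theorem not_hasKernelOn_of_forall_not {N : Matrix ι ι K} {p : ι → Prop} (hp : ∀ i, ¬ p i) :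
    ¬ HasKernelOn N p := by
  rintro ⟨v, hv, hs, -⟩
  exact hv (funext fun i => hs i (hp i))

/-- If `N w` vanishes on `r` and the entries of `w` outside `r` do not contribute to it, then `w`
vanishes on `r` as soon as `N` has no kernel on `r`. -/
theorem eq_zero_of_not_hasKernelOn {N : Matrix ι ι K} {r : ι → Prop} (hr : ¬ HasKernelOn N r)
    {w : ι → K} (hw : ∀ i, r i → (N *ᵥ w) i = 0)
    (hlink : ∀ i j, r i → ¬ r j → N i j * w j = 0) {i : ι} (hi : r i) : w i = 0 := by
  classical
  by_contra hne
  refine hr ⟨fun j => if r j then w j else 0, fun h => hne ?_, fun j hj => if_neg hj, ?_⟩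
  · simpa [hi] using congrFun h i
  · intro k hk
    refine (Finset.sum_congr rfl fun j _ => ?_).trans (hw k hk)
    by_cases hj : r j
    · simp [hj]
    · simp [hj, hlink k j hk hj]

theorem det_submatrix_eq_zero_iff_hasKernelOn (N : Matrix ι ι K) {e : κ → ι}
    (he : Function.Injective e) :
    (N.submatrix e e).det = 0 ↔ HasKernelOn N (fun i => i ∈ Set.range e) := by
  have key : ∀ (w : ι → K), (∀ i, i ∉ Set.range e → w i = 0) → ∀ k,
      (N *ᵥ w) (e k) = (N.submatrix e e *ᵥ (w ∘ e)) k := fun w hw k =>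
    (Fintype.sum_of_injective e he (fun l => N (e k) (e l) * w (e l)) (fun i => N (e k) i * w i)
      (fun i hi => by rw [hw i hi, mul_zero]) (fun _ => rfl)).symm
  rw [← exists_mulVec_eq_zero_iff]
  constructor
  · rintro ⟨v, hv0, hv⟩
    have hs : ∀ i, i ∉ Set.range e → Function.extend e v 0 i = 0 := fun i hi =>
      Function.extend_apply' _ _ _ hi
    have hc : Function.extend e v 0 ∘ e = v := Function.extend_comp he _ _
    refine ⟨Function.extend e v 0, fun h => hv0 ?_, hs, ?_⟩
    · rw [← hc, h]
      rfl
    · rintro _ ⟨k, rfl⟩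
      rw [key _ hs, hc, hv, Pi.zero_apply]
  · rintro ⟨w, hw0, hs, hw⟩
    refine ⟨w ∘ e, fun h => hw0 (funext fun i => ?_), funext fun k => ?_⟩
    · by_cases hi : i ∈ Set.range e
      · obtain ⟨k, rfl⟩ := hi
        exact congrFun h k
      · exact hs i hi
    · rw [← key w hs, hw _ ⟨k, rfl⟩, Pi.zero_apply]

/-- Suppose a vertex `s` is joined to the set `L` only through `t ∈ L`, and `L` is not joined
to `R`. If `L` and `L ∪ {s} ∪ R` have kernels but `R` does not, then `L \ {t}` has a kernel. -/
theorem HasKernelOn.of_bridge {N : Matrix ι ι K} (hN : N.IsSymm) {L R : ι → Prop} {s t : ι}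
    (hts : N t s ≠ 0)
    (h0 : ∀ i j, L i → R j → N i j = 0) (h1 : ∀ i, L i → i ≠ t → N i s = 0)
    (hL : HasKernelOn N L) (hR : ¬ HasKernelOn N R)
    (hall : HasKernelOn N (fun i => L i ∨ i = s ∨ R i)) :
    HasKernelOn N (fun i => L i ∧ i ≠ t) := by
  classical
  have hsymm : ∀ i j, N i j = N j i := fun i j => hN.apply j i
  obtain ⟨v, hv0, hvs, hv⟩ := hL
  obtain ⟨w, hw0, hws, hw⟩ := hall
  have hNvs : (N *ᵥ v) s = N t s * v t := by
    refine (Finset.sum_eq_single t (fun i _ hi => ?_) fun h => absurd (Finset.mem_univ t) h).trans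
      (congrArg (· * v t) (hsymm s t))
    by_cases hLi : L i
    · change N s i * v i = 0
      rw [hsymm, h1 i hLi hi, zero_mul]
    · rw [hvs i hLi, mul_zero]
  have hNv : ∀ i, R i → (N *ᵥ v) i = 0 := fun i hi => Finset.sum_eq_zero fun j _ => by
    by_cases hLj : L j
    · change N i j * v j = 0
      rw [hsymm, h0 j i hLj hi, zero_mul]
    · rw [hvs j hLj, mul_zero]
  have hpair : (N *ᵥ v) s * w s = 0 := by
    have h2 : v ⬝ᵥ (N *ᵥ w) = (N *ᵥ v) ⬝ᵥ w := by
      rw [dotProduct_mulVec, ← mulVec_transpose, hN.eq]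
    have h3 : v ⬝ᵥ (N *ᵥ w) = 0 := Finset.sum_eq_zero fun i _ => by
      by_cases hLi : L i
      · rw [hw i (Or.inl hLi), mul_zero]
      · rw [hvs i hLi, zero_mul]
    rw [h3] at h2
    refine (h2.trans (Finset.sum_eq_single s (fun i _ hi => ?_) (by simp))).symm
    by_cases hLi : L i
    · rw [hv i hLi, zero_mul]
    by_cases hRi : R i
    · rw [hNv i hRi, zero_mul]
    · rw [hws i (by tauto), mul_zero]
  rw [hNvs, mul_assoc, mul_eq_zero, or_iff_right hts, mul_eq_zero] at hpair
  rcases hpair with hvt | hwsz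
  · refine ⟨v, hv0, fun i hi => ?_, fun i hi => hv i hi.1⟩
    by_cases hit : i = t
    · rwa [hit]
    · exact hvs i (by tauto)
  · have hwR : ∀ i, R i → w i = 0 := fun i hi =>
      eq_zero_of_not_hasKernelOn hR (fun k hk => hw k (Or.inr (Or.inr hk))) (fun k j hk hj => by
        by_cases hLj : L j
        · rw [hsymm, h0 j k hLj hk, zero_mul]
        by_cases hjs : j = s
        · rw [hjs, hwsz, mul_zero]
        · rw [hws j (by tauto), mul_zero]) hi
    have hwL : ∀ i, ¬ L i → w i = 0 := fun i hi => by
      by_cases his : i = s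
      · rwa [his]
      by_cases hRi : R i
      · exact hwR i hRi
      · exact hws i (by tauto)
    have hwt : N s t * w t = 0 := by
      have hsum : (N *ᵥ w) s = N s t * w t :=
        Finset.sum_eq_single t (fun i _ hi => ?_) fun h => absurd (Finset.mem_univ t) h
      · rw [← hsum, hw s (Or.inr (Or.inl rfl))]
      by_cases hLi : L i
      · change N s i * w i = 0
        rw [hsymm, h1 i hLi hi, zero_mul]
      · rw [hwL i hLi, mul_zero]
    rw [hsymm, mul_eq_zero, or_iff_right hts] at hwt
    refine ⟨w, hw0, fun i hi => ?_, fun i hi => hw i (Or.inl hi.1)⟩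
    by_cases hit : i = t
    · rwa [hit]
    · exact hwL i (by tauto)

/-- If the cofactor of `N` at a cut vertex `s` vanishes, one of the two sides has a kernel. -/
theorem hasKernelOn_or_of_det_updateRow [DecidableEq ι] {N : Matrix ι ι K} {L R : ι → Prop}
    {s : ι} (hcover : ∀ i, L i ∨ i = s ∨ R i) (hsL : ¬ L s) (hsR : ¬ R s)
    (h0 : ∀ i j, L i → R j → N i j = 0) (h0' : ∀ i j, R i → L j → N i j = 0)
    (hdet : (N.updateRow s (Pi.single s 1)).det = 0) : HasKernelOn N L ∨ HasKernelOn N R := by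
  obtain ⟨v, hv0, hv⟩ := exists_mulVec_eq_zero_iff.mpr hdet
  have hvs : v s = 0 := by
    have := congrFun hv s
    simpa [mulVec, updateRow_self] using this
  have hvi : ∀ i, i ≠ s → (N *ᵥ v) i = 0 := fun i hi => by
    have := congrFun hv i
    simpa [mulVec, updateRow_ne hi] using this
  by_contra! hcon
  have hL : ∀ i, L i → v i = 0 := fun i hi =>
    eq_zero_of_not_hasKernelOn hcon.1 (fun k hk => hvi k (by rintro rfl; exact hsL hk))
      (fun k j hk hj => by
        rcases hcover j with h | rfl | h
        · exact absurd h hj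
        · rw [hvs, mul_zero]
        · rw [h0 k j hk h, zero_mul]) hi
  have hR : ∀ i, R i → v i = 0 := fun i hi =>
    eq_zero_of_not_hasKernelOn hcon.2 (fun k hk => hvi k (by rintro rfl; exact hsR hk))
      (fun k j hk hj => by
        rcases hcover j with h | rfl | h
        · rw [h0' k j hk h, zero_mul]
        · rw [hvs, mul_zero]
        · exact absurd h hj) hi
  exact hv0 (funext fun i => by
    rcases hcover i with h | rfl | h
    · exact hL i h
    · exact hvs
    · exact hR i h)

end HasKernelOn

theorem Pminor_eq_zero_iff {n : ℕ} (N : Matrix (Fin n) (Fin n) ℂ) (s : ℕ) :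
    Pminor N s = 0 ↔ HasKernelOn N (fun i => (i : ℕ) < s) := by
  have hr : ∀ i : Fin n, i ∈ Set.range (fun i : Fin (min s n) =>
      Fin.castLE (min_le_right s n) i) ↔ (i : ℕ) < s := by
    intro i
    constructor
    · rintro ⟨k, rfl⟩
      have := k.2
      simp only [Fin.val_castLE]
      omega
    · exact fun h => ⟨⟨i, lt_min h i.2⟩, rfl⟩
  rw [Pminor, det_submatrix_eq_zero_iff_hasKernelOn N (Fin.castLE_injective _)]
  exact ⟨fun h => h.congr hr, fun h => h.congr fun i => (hr i).symm⟩

theorem Qminor_eq_zero_iff {n : ℕ} (N : Matrix (Fin n) (Fin n) ℂ) (s : ℕ) :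
    Qminor N s = 0 ↔ HasKernelOn N (fun i => s < (i : ℕ)) := by
  have hr : ∀ i : Fin n, i ∈ Set.range (fun i : Fin (n - 1 - s) =>
      (⟨s + 1 + i.1, by have := i.2; omega⟩ : Fin n)) ↔ s < (i : ℕ) := by
    intro i
    constructor
    · rintro ⟨k, rfl⟩
      simp only
      omega
    · exact fun h => ⟨⟨i - (s + 1), by omega⟩, Fin.ext (by simp only; omega)⟩
  rw [Qminor, det_submatrix_eq_zero_iff_hasKernelOn N fun i j hij => by
    simpa [Fin.ext_iff] using hij]
  exact ⟨fun h => h.congr hr, fun h => h.congr fun i => (hr i).symm⟩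

theorem isthH_update {a m b d : ℕ} (M : Matrix (Fin (a + m + b)) (Fin (a + m + b)) ℝ)
    (f : Fin d → Fin (a + m + b)) (E : Fin d → ℝ) (z : Fin d → ℂ) (j : Fin d) (t lam : ℂ) :
    isthH a m b d M f E (Function.update z j t) - lam • 1 =
      (isthH a m b d M f E z - lam • 1).updateRow (f j)
        ((isthH a m b d M f E z - lam • 1) (f j) +
          ((E j : ℂ) * ((t + t⁻¹) - (z j + (z j)⁻¹))) • Pi.single (f j) 1) := by
  ext i k
  have hsum : ∀ i, (∑ l, if f l = i then
        (E l : ℂ) * (Function.update z j t l + (Function.update z j t l)⁻¹) else 0) =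
      (∑ l, if f l = i then (E l : ℂ) * (z l + (z l)⁻¹) else 0) +
        if f j = i then (E j : ℂ) * ((t + t⁻¹) - (z j + (z j)⁻¹)) else 0 := by
    intro i
    rw [← sub_eq_iff_eq_add', ← Finset.sum_sub_distrib,
      Finset.sum_eq_single j (fun l _ hl => by simp [Function.update_of_ne hl]) (by simp)]
    split_ifs
    · simp only [Function.update_self]
      ring
    · ring
  simp only [isthH, Matrix.sub_apply, Matrix.of_apply, hsum, Matrix.updateRow_apply,
    Pi.add_apply, Pi.smul_apply, Pi.single_apply, smul_eq_mul]
  by_cases hi : i = f j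
  · subst hi
    by_cases hk : f j = k
    · subst hk
      simp
      ring
    · simp [hk, Ne.symm hk]
  · by_cases hk : i = k
    · rw [if_pos hk, if_neg (Ne.symm hi), if_neg hi, add_zero, if_pos hk]
    · rw [if_neg hk, if_neg hi, if_neg hk]

theorem isthPD_eq {a m b d : ℕ} (M : Matrix (Fin (a + m + b)) (Fin (a + m + b)) ℝ)
    (f : Fin d → Fin (a + m + b)) (E : Fin d → ℝ) (z : Fin d → ℂ) (j : Fin d) (lam : ℂ)
    (hz : z j ≠ 0) :
    isthPD a m b d M f E j z lam = (E j : ℂ) * (1 - ((z j) ^ 2)⁻¹) *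
      ((isthH a m b d M f E z - lam • 1).updateRow (f j) (Pi.single (f j) 1)).det := by
  have hD : ∀ t, isthD a m b d M f E (Function.update z j t) lam =
      (isthH a m b d M f E z - lam • 1).det +
        ((E j : ℂ) * ((t + t⁻¹) - (z j + (z j)⁻¹))) *
        ((isthH a m b d M f E z - lam • 1).updateRow (f j) (Pi.single (f j) 1)).det := by
    intro t
    rw [isthD, isthH_update, Matrix.det_updateRow_add, Matrix.det_updateRow_smul,
      Matrix.updateRow_eq_self]
  simp only [isthPD, hD]
  have h := (((((hasDerivAt_id (z j)).add (hasDerivAt_inv hz)).sub_const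
    (z j + (z j)⁻¹)).const_mul (E j : ℂ)).mul_const
    ((isthH a m b d M f E z - lam • 1).updateRow (f j) (Pi.single (f j) 1)).det).const_add
    (isthH a m b d M f E z - lam • 1).det
  refine h.deriv.trans ?_
  ring

/-- In the isthmus setting with generic parameters, if `(x,λ₀)` is a critical point of `D`
and `x_j² ≠ 1` for some `j`, then `P_{f(j)}(x,λ₀) = 0` and `Q_{f(j)}(x,λ₀) = 0`. -/
theorem stmt_10 (a b m d : ℕ) (hm : 1 ≤ m) (hd : 1 ≤ d)
    (M : Matrix (Fin (a + m + b)) (Fin (a + m + b)) ℝ)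
    (hMs : M.IsSymm)
    -- zero pattern of M
    (hM0 : ∀ i j : Fin (a + m + b), (i : ℕ) < (j : ℕ) →
      ¬((j : ℕ) + 1 ≤ a) → ¬(a + m ≤ (i : ℕ)) →
      ¬((j : ℕ) = (i : ℕ) + 1 ∧ a ≤ (i : ℕ) + 1 ∧ (i : ℕ) ≤ a + m - 1) →
      M i j = 0)
    (f : Fin d → Fin (a + m + b))
    (hf : ∀ j, a ≤ (f j : ℕ) ∧ (f j : ℕ) ≤ a + m - 1)
    (E : Fin d → ℝ)
    -- (G1) the consecutive entries M_{i,i+1}, a−1 ≤ i ≤ a+m−1, and all E_j are nonzero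
    (hG1M : ∀ i : ℕ, a ≤ i + 1 → i ≤ a + m - 1 → ∀ h : i + 1 < a + m + b,
      M ⟨i, by omega⟩ ⟨i + 1, h⟩ ≠ 0)
    (hG1E : ∀ j, E j ≠ 0)
    -- (G2) at corner points, P_t and Q_{t'} (t ≤ t' isthmus indices) have no common root,
    -- and neither has a root in common with D
    (hG2 : ∀ x : Fin d → ℂ, (∀ j, x j = 1 ∨ x j = -1) →
      ∀ t t' : ℕ, a ≤ t → t ≤ t' → t' ≤ a + m - 1 → ∀ lam : ℂ,
        (¬(isthP a m b d M f E t x lam = 0 ∧ isthQ a m b d M f E t' x lam = 0)) ∧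
        (isthD a m b d M f E x lam = 0 →
          isthP a m b d M f E t x lam ≠ 0 ∧ isthQ a m b d M f E t' x lam ≠ 0))
    -- (G3) the boundary minors have no common roots
    (hG3a : 0 < a → ∀ (x : Fin d → ℂ) (lam : ℂ),
      ¬(isthP a m b d M f E (a - 1) x lam = 0 ∧ isthP a m b d M f E a x lam = 0))
    (hG3b : 0 < b → ∀ (x : Fin d → ℂ) (lam : ℂ),
      ¬(isthQ a m b d M f E (a + m - 1) x lam = 0 ∧ isthQ a m b d M f E (a + m) x lam = 0)) :
    ∀ (x : Fin d → ℂ) (lam0 : ℂ), (∀ j, x j ≠ 0) →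
      isthD a m b d M f E x lam0 = 0 →
      (∀ j, isthPD a m b d M f E j x lam0 = 0) →
      ∀ j : Fin d, (x j) ^ 2 ≠ 1 →
        isthP a m b d M f E (f j : ℕ) x lam0 = 0 ∧
        isthQ a m b d M f E (f j : ℕ) x lam0 = 0 := by
  intro x lam0 hx hD hPD j hxj
  set N := isthH a m b d M f E x - lam0 • 1 with hNdef
  have hoff : ∀ i k, i ≠ k → N i k = (M i k : ℂ) := fun i k hik => by
    simp [hNdef, isthH, hik]
  have hsymm : N.IsSymm := by
    ext i k
    by_cases hik : i = k
    · rw [hik, Matrix.transpose_apply]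
    · rw [Matrix.transpose_apply, hoff _ _ hik, hoff _ _ (Ne.symm hik), hMs.apply]
  have hzero : ∀ i k : Fin (a + m + b), (i : ℕ) < k → a ≤ (k : ℕ) → (i : ℕ) < a + m →
      (k : ℕ) ≠ i + 1 → N i k = 0 := fun i k hik hk hi hne => by
    rw [hoff i k (by rintro rfl; omega),
      hM0 i k hik (by omega) (by omega) (fun h => hne h.1), Complex.ofReal_zero]
  have hedge : ∀ i k : Fin (a + m + b), (k : ℕ) = i + 1 → a ≤ (k : ℕ) → (i : ℕ) < a + m →
      N i k ≠ 0 := fun i k hik hk hi => by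
    obtain ⟨i, hi'⟩ := i
    obtain ⟨k, hk'⟩ := k
    simp only at hik hk hi
    subst hik
    rw [hoff _ _ (by simp)]
    exact Complex.ofReal_ne_zero.mpr (hG1M i hk (by omega) hk')
  have hstepP : ∀ s : Fin (a + m + b), a ≤ (s : ℕ) → (s : ℕ) < a + m → ∀ r : ℕ,
      HasKernelOn N (fun i => (i : ℕ) < s) →
      ¬ HasKernelOn N (fun i => (s : ℕ) < i ∧ (i : ℕ) < r) → (s : ℕ) < r →
      HasKernelOn N (fun i => (i : ℕ) < r) →
      0 < (s : ℕ) ∧ HasKernelOn N (fun i => (i : ℕ) < s - 1) := by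
    intro s hs1 hs2 r hL hR hsr hall
    have hs0 : 0 < (s : ℕ) := by
      by_contra h
      exact not_hasKernelOn_of_forall_not (fun i => by omega) hL
    refine ⟨hs0, (HasKernelOn.of_bridge hsymm (L := fun i => (i : ℕ) < s)
      (R := fun i => (s : ℕ) < i ∧ (i : ℕ) < r) (s := s) (t := ⟨s - 1, by omega⟩) (hedge _ _ (by simp only; omega) hs1
        (by simp only; omega)) (fun i k hi hk => hzero i k (by omega) (by omega) (by omega)
        (by omega)) (fun i hi hit => hzero i s hi hs1 (by omega) (fun h => hit ?_)) hL hR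
        (hall.congr fun i => ?_)).congr fun i => ?_⟩ <;>
      simp only [Fin.ext_iff, ne_eq] <;> omega
  have hstepQ : ∀ s : Fin (a + m + b), a ≤ (s : ℕ) → (s : ℕ) < a + m → ∀ r : ℕ,
      HasKernelOn N (fun i => (s : ℕ) < i) →
      ¬ HasKernelOn N (fun i => (i : ℕ) < s ∧ r ≤ (i : ℕ)) → r ≤ (s : ℕ) →
      HasKernelOn N (fun i => r ≤ (i : ℕ)) →
      (s : ℕ) + 1 < a + m + b ∧ HasKernelOn N (fun i => (s : ℕ) + 1 < i) := by
    intro s hs1 hs2 r hL hR hsr hall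
    have hs0 : (s : ℕ) + 1 < a + m + b := by
      by_contra h
      exact not_hasKernelOn_of_forall_not (fun i => by omega) hL
    refine ⟨hs0, (HasKernelOn.of_bridge hsymm (L := fun i => (s : ℕ) < i)
      (R := fun i => (i : ℕ) < s ∧ r ≤ (i : ℕ)) (s := s) (t := ⟨s + 1, hs0⟩) (by
        rw [hsymm.apply]
        exact hedge _ _ rfl (by simp only; omega) hs2)
      (fun i k hi hk => by
        rw [← hsymm.apply]
        exact hzero k i (by omega) (by omega) (by omega) (by omega))
      (fun i hi hit => by
        rw [← hsymm.apply]
        exact hzero s i hi (by omega) hs2 (fun h => hit (Fin.ext h))) hL hR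
        (hall.congr fun i => ?_)).congr fun i => ?_⟩ <;>
      simp only [Fin.ext_iff, ne_eq] <;> omega
  have hconsP : ∀ k : ℕ, a ≤ k + 1 → k < a + m →
      ¬ (HasKernelOn N (fun i => (i : ℕ) < k) ∧ HasKernelOn N (fun i => (i : ℕ) < k + 1)) := by
    intro k
    induction k with
    | zero => exact fun _ _ h => not_hasKernelOn_of_forall_not (fun i => by omega) h.1
    | succ k ih =>
      rintro h1 h2 ⟨hk, hk1⟩
      by_cases ha : a = k + 2
      · refine hG3a (by omega) x lam0 ⟨?_, ?_⟩
        · rw [isthP, Pminor_eq_zero_iff]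
          exact hk.congr fun i => by omega
        · rw [isthP, Pminor_eq_zero_iff]
          exact hk1.congr fun i => by omega
      · exact ih (by omega) (by omega) ⟨(hstepP ⟨k + 1, by omega⟩ (by simp only; omega) h2 (k + 2)
          hk (not_hasKernelOn_of_forall_not (fun i => by simp only; omega)) (by simp) hk1).2, hk⟩
  have hconsQ : ∀ l k : ℕ, k + l + 1 = a + m → a ≤ k →
      ¬ (HasKernelOn N (fun i => k < (i : ℕ)) ∧ HasKernelOn N (fun i => k + 1 < (i : ℕ))) := by
    intro l
    induction l with
    | zero =>
      rintro k h1 h2 ⟨hk, hk1⟩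
      rcases Nat.eq_zero_or_pos b with hb | hb
      · exact not_hasKernelOn_of_forall_not (fun i => by omega) hk
      · refine hG3b hb x lam0 ⟨?_, ?_⟩
        · rw [isthQ, Qminor_eq_zero_iff]
          exact hk.congr fun i => by omega
        · rw [isthQ, Qminor_eq_zero_iff]
          exact hk1.congr fun i => by omega
    | succ l ih =>
      rintro k h1 h2 ⟨hk, hk1⟩
      exact ih (k + 1) (by omega) (by omega) ⟨hk1, (hstepQ ⟨k + 1, by omega⟩ (by simp only; omega)
        (by simp only; omega) (k + 1) hk1
        (not_hasKernelOn_of_forall_not (fun i => by simp only; omega)) le_rfl hk).2⟩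
  obtain ⟨hs1, hs2⟩ := hf j
  set s := f j with hs
  have hdet : HasKernelOn N (fun _ => True) := by
    obtain ⟨v, hv0, hv⟩ := Matrix.exists_mulVec_eq_zero_iff.mpr hD
    exact ⟨v, hv0, fun i hi => absurd trivial hi, fun i _ => congrFun hv i⟩
  have hor : HasKernelOn N (fun i => (i : ℕ) < s) ∨ HasKernelOn N (fun i => (s : ℕ) < i) := by
    refine hasKernelOn_or_of_det_updateRow (L := fun i : Fin (a + m + b) => (i : ℕ) < s)
      (R := fun i : Fin (a + m + b) => (s : ℕ) < i) (s := s) (fun i => ?_) (lt_irrefl _) (lt_irrefl _)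
      (fun i k hi hk => hzero i k (by omega) (by omega) (by omega) (by omega))
      (fun i k hi hk => ?_) ?_
    · rw [Fin.ext_iff]
      omega
    · rw [← hsymm.apply]
      exact hzero k i (by omega) (by omega) (by omega) (by omega)
    · have h := hPD j
      rw [isthPD_eq M f E x j lam0 (hx j), mul_eq_zero, mul_eq_zero] at h
      rcases h with (h | h) | h
      · exact absurd (Complex.ofReal_eq_zero.mp h) (hG1E j)
      · exact absurd (inv_eq_one.mp (sub_eq_zero.mp h).symm) hxj
      · exact h
  rw [isthP, isthQ, Pminor_eq_zero_iff, Qminor_eq_zero_iff]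
  refine ⟨?_, ?_⟩
  · by_contra hP
    have hQ := hor.resolve_left hP
    obtain ⟨-, h⟩ := hstepQ s hs1 (by omega) 0 hQ (fun h => hP (h.congr fun i => by omega))
      (Nat.zero_le _) (hdet.congr fun i => by simp)
    exact hconsQ (a + m - 1 - s) s (by omega) hs1 ⟨hQ, h⟩
  · by_contra hQ
    have hP := hor.resolve_right hQ
    obtain ⟨h0, h⟩ := hstepP s hs1 (by omega) (a + m + b) hP
      (fun h => hQ (h.congr fun i => by omega)) s.2 (hdet.congr fun i => by simp)
    exact hconsP (s - 1) (by omega) (by omega) ⟨h, hP.congr fun i => by omega⟩
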